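/- arXiv:2002.03250 — 2 statements merged into one kernel-verified Lean document; each statement's English description precedes it below -/
import Mathlib

section
/- ∫_0^1 ln(1−x)/x · ln(ln(1/x)) dx = γπ²/6 − ζ'(2). -/
open MeasureTheory Real

/-- The Riemann zeta function as a real function, `ζ(s) = ∑_{n ≥ 1} n^{-s}`. -/
noncomputable def zetaR (s : ℝ) : ℝ := ∑' n : ℕ, ((n : ℝ) + 1) ^ (-s)

theorem integral_log_mul_exp_neg :
    ∫ t in Set.Ioi (0 : ℝ), log t * exp (-t) = -eulerMascheroniConstant := by
  have h1 := Complex.hasDerivAt_GammaIntegral (s := 1) (by simp)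
  have h2 : HasDerivAt Complex.GammaIntegral (-(eulerMascheroniConstant : ℂ)) 1 := by
    refine Complex.hasDerivAt_Gamma_one.congr_of_eventuallyEq ?_
    have : {z : ℂ | 0 < z.re} ∈ nhds (1 : ℂ) :=
      (isOpen_lt continuous_const Complex.continuous_re).mem_nhds (by simp)
    filter_upwards [this] with z hz
    exact (Complex.Gamma_eq_integral hz).symm
  have h3 := h1.unique h2
  simp only [sub_self, Complex.cpow_zero, one_mul, ← Complex.ofReal_mul, ← Complex.ofReal_neg] at h3
  exact Complex.ofReal_injective (integral_complex_ofReal.symm.trans h3)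

theorem integrableOn_log_mul_exp_neg :
    IntegrableOn (fun t : ℝ => log t * exp (-t)) (Set.Ioi 0) := by
  by_contra h
  have h1 := integral_log_mul_exp_neg
  rw [integral_undef h] at h1
  linarith [one_half_lt_eulerMascheroniConstant]

theorem integrableOn_exp_neg_Ioi_zero : IntegrableOn (fun t : ℝ => exp (-t)) (Set.Ioi 0) :=
  integrableOn_exp_neg_Ioi 0

/-- The scaling form of the integrand: `log t = log (a t) - log a`. -/
theorem log_mul_exp_neg_mul_eq {a t : ℝ} (ha : 0 < a) (ht : 0 < t) :
    log t * exp (-(a * t)) = log (a * t) * exp (-(a * t)) - log a * exp (-(a * t)) := by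
  rw [log_mul ha.ne' ht.ne']; ring

theorem integrableOn_log_mul_exp_neg_mul {a : ℝ} (ha : 0 < a) :
    IntegrableOn (fun t : ℝ => log t * exp (-(a * t))) (Set.Ioi 0) := by
  have h := (integrableOn_Ioi_comp_mul_left_iff
    (fun t : ℝ => log t * exp (-t) - log a * exp (-t)) 0 ha).2 (by
      rw [mul_zero]
      exact integrableOn_log_mul_exp_neg.sub (integrableOn_exp_neg_Ioi_zero.const_mul _))
  exact h.congr_fun (fun t ht => (log_mul_exp_neg_mul_eq ha ht).symm) measurableSet_Ioi

theorem integral_log_mul_exp_neg_mul {a : ℝ} (ha : 0 < a) :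
    ∫ t in Set.Ioi (0 : ℝ), log t * exp (-(a * t)) = -(eulerMascheroniConstant + log a) / a := by
  rw [setIntegral_congr_fun measurableSet_Ioi (fun t ht => log_mul_exp_neg_mul_eq ha ht),
    integral_comp_mul_left_Ioi (fun t : ℝ => log t * exp (-t) - log a * exp (-t)) 0 ha, mul_zero,
    integral_sub integrableOn_log_mul_exp_neg (integrableOn_exp_neg_Ioi_zero.const_mul _),
    integral_const_mul, integral_exp_neg_Ioi_zero, integral_log_mul_exp_neg, smul_eq_mul]
  field_simp
  ring

theorem integral_abs_log_mul_exp_neg_mul_le {a : ℝ} (ha : 1 ≤ a) :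
    ∫ t in Set.Ioi (0 : ℝ), |log t * exp (-(a * t))| ≤
      ((∫ t in Set.Ioi (0 : ℝ), |log t * exp (-t)|) + log a) / a := by
  have ha0 : 0 < a := by linarith
  have hi : IntegrableOn (fun t : ℝ => |log t * exp (-t)| + log a * exp (-t)) (Set.Ioi 0) :=
    integrableOn_log_mul_exp_neg.abs.add (integrableOn_exp_neg_Ioi_zero.const_mul _)
  calc _ ≤ ∫ t in Set.Ioi (0 : ℝ), (|log (a * t) * exp (-(a * t))| + log a * exp (-(a * t))) := by
        refine setIntegral_mono_on (integrableOn_log_mul_exp_neg_mul ha0).abs ?_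
          measurableSet_Ioi fun t ht => ?_
        · refine (integrableOn_Ioi_comp_mul_left_iff
            (fun t : ℝ => |log t * exp (-t)| + log a * exp (-t)) 0 ha0).2 ?_
          rwa [mul_zero]
        · rw [log_mul_exp_neg_mul_eq ha0 ht]
          refine (abs_sub _ _).trans_eq ?_
          rw [abs_of_nonneg (mul_nonneg (log_nonneg ha) (exp_pos (-(a * t))).le)]
    _ = _ := by
        rw [integral_comp_mul_left_Ioi
          (fun t : ℝ => |log t * exp (-t)| + log a * exp (-t)) 0 ha0, mul_zero,
          integral_add integrableOn_log_mul_exp_neg.abs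
            (integrableOn_exp_neg_Ioi_zero.const_mul _),
          integral_const_mul, integral_exp_neg_Ioi_zero, smul_eq_mul]
        field_simp

theorem summable_nat_add_one_rpow {p : ℝ} (hp : p < -1) :
    Summable fun n : ℕ => ((n : ℝ) + 1) ^ p := by
  simpa using (summable_nat_add_iff 1).2 (Real.summable_nat_rpow.2 hp)

theorem summable_log_mul_nat_add_one_rpow {p : ℝ} (hp : p < -1) :
    Summable fun n : ℕ => log ((n : ℝ) + 1) * ((n : ℝ) + 1) ^ p := by
  set ε : ℝ := (-1 - p) / 2 with hε
  have hε0 : 0 < ε := by linarith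
  refine Summable.of_nonneg_of_le (fun n => ?_) (fun n => ?_)
    ((summable_nat_add_one_rpow (p := ε + p) (by linarith)).mul_left ε⁻¹)
  · exact mul_nonneg (log_nonneg (by linarith [n.cast_nonneg (α := ℝ)])) (by positivity)
  · have h := log_le_rpow_div (x := (n : ℝ) + 1) (by positivity) hε0
    calc _ ≤ ((n : ℝ) + 1) ^ ε / ε * ((n : ℝ) + 1) ^ p := by gcongr
      _ = _ := by rw [rpow_add (by positivity)]; ring

theorem hasDerivAt_zetaR {s : ℝ} (hs : 1 < s) :
    HasDerivAt zetaR (-∑' n : ℕ, log ((n : ℝ) + 1) * ((n : ℝ) + 1) ^ (-s)) s := by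
  rw [← tsum_neg]
  refine hasDerivAt_tsum_of_isPreconnected
    (g := fun (n : ℕ) (z : ℝ) => ((n : ℝ) + 1) ^ (-z))
    (g' := fun (n : ℕ) (z : ℝ) => -(log ((n : ℝ) + 1) * ((n : ℝ) + 1) ^ (-z)))
    (summable_log_mul_nat_add_one_rpow (p := -((1 + s) / 2)) (by linarith))
    (isOpen_Ioi (a := (1 + s) / 2)) isPreconnected_Ioi (fun n y _ => ?_) (fun n y hy => ?_)
    (y₀ := s) (by simp; linarith) (summable_nat_add_one_rpow (by linarith)) (by simp; linarith)
  · convert! (hasDerivAt_neg y).const_rpow (a := (n : ℝ) + 1) (by positivity) using 1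
    ring
  · have h1 : (1 : ℝ) ≤ (n : ℝ) + 1 := by linarith [n.cast_nonneg (α := ℝ)]
    have h2 := log_nonneg h1
    rw [norm_neg, norm_of_nonneg (by positivity)]
    gcongr
    exact hy.le

theorem hasSum_nat_add_one_zeta_two :
    HasSum (fun n : ℕ => 1 / ((n : ℝ) + 1) ^ 2) (π ^ 2 / 6) := by
  simpa using (hasSum_nat_add_iff' 1).2 hasSum_zeta_two

theorem integral_log_one_sub_exp_neg_mul_log :
    ∫ t in Set.Ioi (0 : ℝ), log (1 - exp (-t)) * log t =
      ∑' n : ℕ, (eulerMascheroniConstant + log ((n : ℝ) + 1)) / ((n : ℝ) + 1) ^ 2 := by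
  obtain ⟨C, hC⟩ : ∃ C, ∫ t in Set.Ioi (0 : ℝ), |log t * exp (-t)| = C := ⟨_, rfl⟩
  have hpos (n : ℕ) : (0 : ℝ) < (n : ℝ) + 1 := by positivity
  have h := hasSum_integral_of_summable_integral_norm (μ := volume.restrict (Set.Ioi (0 : ℝ)))
    (F := fun (n : ℕ) (t : ℝ) => -((n : ℝ) + 1)⁻¹ * (log t * exp (-(((n : ℝ) + 1) * t))))
    (fun n => (integrableOn_log_mul_exp_neg_mul (hpos n)).const_mul _) (by
      refine Summable.of_nonneg_of_le (fun n => integral_nonneg fun t => norm_nonneg _)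
        (fun n => ?_) ((hasSum_nat_add_one_zeta_two.summable.mul_left C).add
          (summable_log_mul_nat_add_one_rpow (p := -2) (by norm_num)))
      have h1 := integral_abs_log_mul_exp_neg_mul_le (a := (n : ℝ) + 1)
        (by linarith [n.cast_nonneg (α := ℝ)])
      rw [hC] at h1
      simp only [abs_mul] at h1
      simp only [norm_mul, norm_neg, norm_inv, norm_of_nonneg (hpos n).le,
        integral_const_mul, norm_eq_abs]
      calc _ ≤ ((n : ℝ) + 1)⁻¹ * ((C + log ((n : ℝ) + 1)) / ((n : ℝ) + 1)) := by gcongr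
        _ = _ := by
          rw [rpow_neg (hpos n).le, rpow_two]
          field_simp)
  rw [setIntegral_congr_fun measurableSet_Ioi (g := fun t : ℝ =>
    ∑' n : ℕ, -((n : ℝ) + 1)⁻¹ * (log t * exp (-(((n : ℝ) + 1) * t)))), ← h.tsum_eq]
  · refine tsum_congr fun n => ?_
    rw [integral_const_mul, integral_log_mul_exp_neg_mul (hpos n)]
    field_simp
  · intro t ht
    have h1 : |exp (-t)| < 1 := by
      rw [abs_of_pos (exp_pos _)]
      exact exp_lt_one_iff.2 (neg_lt_zero.2 ht)
    have h2 := (hasSum_pow_div_log_of_abs_lt_one h1).mul_right (-log t)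
    rw [neg_mul_neg] at h2
    change log (1 - exp (-t)) * log t = _
    rw [← h2.tsum_eq]
    refine tsum_congr fun n => ?_
    rw [← exp_nat_mul, show ((n + 1 : ℕ) : ℝ) * -t = -(((n : ℝ) + 1) * t) by push_cast; ring]
    field_simp

theorem image_exp_neg_Ioi_zero : (fun t : ℝ => exp (-t)) '' Set.Ioi 0 = Set.Ioo 0 1 := by
  ext x
  constructor
  · rintro ⟨t, ht, rfl⟩
    exact ⟨exp_pos _, exp_lt_one_iff.2 (neg_lt_zero.2 ht)⟩
  · rintro ⟨h0, h1⟩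
    exact ⟨-log x, neg_pos.2 (log_neg h0 h1), by simp [exp_log h0]⟩

theorem integral_log_one_sub_div_mul_loglog :
    ∫ x in Set.Ioo (0 : ℝ) 1,
        Real.log (1 - x) / x * Real.log (Real.log (1 / x))
      = Real.eulerMascheroniConstant * Real.pi ^ 2 / 6 - deriv zetaR 2 := by
  rw [← image_exp_neg_Ioi_zero, integral_image_eq_integral_abs_deriv_smul
    (f' := fun t => -exp (-t)) measurableSet_Ioi
    (fun t _ => by simpa using ((hasDerivAt_neg t).exp).hasDerivWithinAt)
    (fun x _ y _ hxy => by simpa using hxy)]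
  have h1 : ∀ t : ℝ, |-exp (-t)| • (log (1 - exp (-t)) / exp (-t) * log (log (1 / exp (-t)))) =
      log (1 - exp (-t)) * log t := fun t => by
    rw [abs_neg, abs_of_pos (exp_pos _), one_div, ← exp_neg, neg_neg, log_exp, smul_eq_mul]
    field_simp
  simp only [h1]
  rw [integral_log_one_sub_exp_neg_mul_log, (hasDerivAt_zetaR one_lt_two).deriv, sub_neg_eq_add,
    mul_div_assoc, ← hasSum_nat_add_one_zeta_two.tsum_eq, ← tsum_mul_left,
    ← (hasSum_nat_add_one_zeta_two.summable.mul_left _).tsum_add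
      (summable_log_mul_nat_add_one_rpow (by norm_num))]
  refine tsum_congr fun n => ?_
  rw [rpow_neg (by positivity), rpow_two]
  field_simp
end

section
/- ∫_0^1 ln(ln(1/x)) / (1 + x + x²) dx = (π/√3) · ln( (2π)^{1/3} Γ(2/3) / Γ(1/3) ). -/
open MeasureTheory Real

open Set Filter Topology Asymptotics HurwitzZeta

/-- An odd second difference of a function with bounded second derivative is bounded. -/
lemma norm_odd_difference_le {g g' g'' : ℝ → ℂ} {b M a : ℝ} (ha : a ∈ Icc (0 : ℝ) 1)
    (hg : ∀ u ∈ Icc b (b + 1), HasDerivAt g (g' u) u)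
    (hg' : ∀ u ∈ Icc b (b + 1), HasDerivAt g' (g'' u) u)
    (hM : ∀ u ∈ Icc b (b + 1), ‖g'' u‖ ≤ M) :
    ‖g (b + a) - g (b + 1 - a) - (1 - 2 * a) * (g b - g (b + 1))‖ ≤ 2 * M := by
  have hb : b ∈ Icc b (b + 1) := ⟨le_rfl, by linarith⟩
  have hb1 : b + 1 ∈ Icc b (b + 1) := ⟨by linarith, le_rfl⟩
  have hM0 : 0 ≤ M := (norm_nonneg _).trans (hM b hb)
  have hP' : ∀ u ∈ Icc b (b + 1), ‖g' u - g' b‖ ≤ M := fun u hu ↦ by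
    refine ((convex_Icc b (b + 1)).norm_image_sub_le_of_norm_hasDerivWithin_le
      (fun v hv ↦ (hg' v hv).hasDerivWithinAt) hM hb hu).trans ?_
    refine mul_le_of_le_one_right hM0 ?_
    rw [Real.norm_eq_abs, abs_le]
    constructor <;> linarith [hu.1, hu.2]
  have hP : ∀ u ∈ Icc b (b + 1), ∀ v ∈ Icc b (b + 1),
      ‖(g v - v * g' b) - (g u - u * g' b)‖ ≤ M * ‖v - u‖ := fun u hu v hv ↦ by
    refine (convex_Icc b (b + 1)).norm_image_sub_le_of_norm_hasDerivWithin_le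
      (f := fun u : ℝ ↦ g u - u * g' b)
      (fun w hw ↦ HasDerivAt.hasDerivWithinAt ?_) hP' hu hv
    have hid : HasDerivAt (fun u : ℝ ↦ (u : ℂ) * g' b) (g' b) w := by
      simpa using (hasDerivAt_id (w : ℂ)).comp_ofReal.mul_const (g' b)
    exact (hg w hw).sub hid
  have hlen : ‖(b + a) - (b + 1 - a)‖ ≤ 1 := by
    rw [Real.norm_eq_abs, abs_le]
    constructor <;> linarith [ha.1, ha.2]
  have h1 := (hP (b + 1 - a) ⟨by linarith [ha.2], by linarith [ha.1]⟩ (b + a)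
    ⟨by linarith [ha.1], by linarith [ha.2]⟩).trans (mul_le_of_le_one_right hM0 hlen)
  have h2 : ‖(g b - b * g' b) - (g (b + 1) - ((b + 1 : ℝ) : ℂ) * g' b)‖ ≤ M := by
    simpa using hP (b + 1) hb1 b hb
  have h3 : ‖(1 - 2 * a : ℂ)‖ ≤ 1 := by
    have : (1 - 2 * a : ℂ) = ((1 - 2 * a : ℝ) : ℂ) := by push_cast; ring
    rw [this, Complex.norm_real, Real.norm_eq_abs, abs_le]
    constructor <;> linarith [ha.1, ha.2]
  calc _ = ‖((g (b + a) - ((b + a : ℝ) : ℂ) * g' b)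
          - (g (b + 1 - a) - ((b + 1 - a : ℝ) : ℂ) * g' b))
          - (1 - 2 * a) * ((g b - b * g' b) - (g (b + 1) - ((b + 1 : ℝ) : ℂ) * g' b))‖ := by
        congr 1; push_cast; ring
    _ ≤ M + 1 * M := (norm_sub_le _ _).trans (add_le_add h1 (by
        rw [norm_mul]; exact mul_le_mul h3 h2 (norm_nonneg _) zero_le_one))
    _ = 2 * M := by ring

/-- The terms of an accelerated series for the odd Hurwitz zeta function. -/
noncomputable def oddHurwitzTerm (a : ℝ) (n : ℕ) (s : ℂ) : ℂ :=
  ((n + 1 + a : ℝ) : ℂ) ^ (-s) - ((n + 1 + 1 - a : ℝ) : ℂ) ^ (-s)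
    - (1 - 2 * a) * (((n + 1 : ℝ) : ℂ) ^ (-s) - ((n + 1 + 1 : ℝ) : ℂ) ^ (-s))

lemma hasDerivAt_ofReal_cpow {u : ℝ} (hu : 0 < u) (s : ℂ) :
    HasDerivAt (fun v : ℝ ↦ (v : ℂ) ^ s) (s * (u : ℂ) ^ (s - 1)) u := by
  simpa using ((hasDerivAt_id (u : ℂ)).cpow_const (c := s)
    (Complex.ofReal_mem_slitPlane.2 hu)).comp_ofReal

lemma norm_oddHurwitzTerm_le {a : ℝ} (ha : a ∈ Icc (0 : ℝ) 1) (n : ℕ) {s : ℂ}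
    (hs : -(1 / 2) < s.re) (hs' : ‖s‖ < 2) :
    ‖oddHurwitzTerm a n s‖ ≤ 12 * ((n + 1 : ℕ) : ℝ) ^ (-(3 / 2) : ℝ) := by
  have hn : (1 : ℝ) ≤ n + 1 := by simp
  have hM : ∀ u ∈ Icc (n + 1 : ℝ) (n + 1 + 1),
      ‖-s * ((-s - 1) * (u : ℂ) ^ (-s - 1 - 1))‖ ≤ 6 * (n + 1 : ℝ) ^ (-(3 / 2) : ℝ) := by
    intro u hu
    have hu0 : 0 < u := by linarith [hu.1]
    rw [norm_mul, norm_mul, Complex.norm_cpow_eq_rpow_re_of_pos hu0, ← mul_assoc]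
    have h1 : ‖-s - 1‖ ≤ 3 := by
      refine (norm_sub_le _ _).trans ?_
      rw [norm_neg, norm_one]; linarith
    have h2 : u ^ (-s - 1 - 1).re ≤ (n + 1 : ℝ) ^ (-(3 / 2) : ℝ) := by
      refine (Real.rpow_le_rpow_of_exponent_le (hn.trans hu.1) (z := -(3 / 2)) ?_).trans
        (Real.rpow_le_rpow_of_nonpos (by linarith) hu.1 (by norm_num))
      simp; linarith
    refine mul_le_mul ?_ h2 (by positivity) (by norm_num)
    rw [norm_neg]
    nlinarith [norm_nonneg s, norm_nonneg (-s - 1)]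
  have := norm_odd_difference_le ha (g := fun u : ℝ ↦ (u : ℂ) ^ (-s))
    (fun u hu ↦ hasDerivAt_ofReal_cpow (by linarith [hu.1]) (-s))
    (fun u hu ↦ (hasDerivAt_ofReal_cpow (by linarith [hu.1]) (-s - 1)).const_mul (-s)) hM
  refine this.trans (le_of_eq ?_)
  push_cast; ring

lemma summable_oddHurwitzBound :
    Summable fun n : ℕ ↦ 12 * ((n + 1 : ℕ) : ℝ) ^ (-(3 / 2) : ℝ) :=
  ((summable_nat_add_iff 1).2 (Real.summable_nat_rpow.2 (by norm_num))).mul_left 12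

lemma hasDerivAt_ofReal_cpow_neg {b : ℝ} (hb : 0 < b) (s : ℂ) :
    HasDerivAt (fun z : ℂ ↦ (b : ℂ) ^ (-z)) (-((b : ℂ) ^ (-s) * Real.log b)) s := by
  have := (hasDerivAt_neg s).const_cpow (c := (b : ℂ)) (Or.inl (by exact_mod_cast hb.ne'))
  simpa [Complex.ofReal_log hb.le] using this

lemma hasDerivAt_oddHurwitzTerm {a : ℝ} (ha : a ∈ Icc (0 : ℝ) 1) (n : ℕ) (s : ℂ) :
    HasDerivAt (oddHurwitzTerm a n)
      (-(((n + 1 + a : ℝ) : ℂ) ^ (-s) * Real.log (n + 1 + a))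
        - -(((n + 1 + 1 - a : ℝ) : ℂ) ^ (-s) * Real.log (n + 1 + 1 - a))
        - (1 - 2 * a) * (-(((n + 1 : ℝ) : ℂ) ^ (-s) * Real.log (n + 1))
          - -(((n + 1 + 1 : ℝ) : ℂ) ^ (-s) * Real.log (n + 1 + 1)))) s := by
  have hn : (0 : ℝ) ≤ n := n.cast_nonneg
  exact ((hasDerivAt_ofReal_cpow_neg (by linarith [ha.1]) s).sub
    (hasDerivAt_ofReal_cpow_neg (by linarith [ha.2]) s)).sub
    (((hasDerivAt_ofReal_cpow_neg (by linarith) s).sub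
      (hasDerivAt_ofReal_cpow_neg (by linarith) s)).const_mul _)

/-- The region on which the accelerated series is used. -/
def oddHurwitzRegion : Set ℂ := {s | -(1 / 2) < s.re} ∩ Metric.ball 0 2

lemma isOpen_oddHurwitzRegion : IsOpen oddHurwitzRegion :=
  (isOpen_lt continuous_const Complex.continuous_re).inter Metric.isOpen_ball

lemma isPreconnected_oddHurwitzRegion : IsPreconnected oddHurwitzRegion :=
  ((convex_halfSpace_re_gt _).inter (convex_ball _ _)).isPreconnected

lemma norm_oddHurwitzTerm_le_of_mem {a : ℝ} (ha : a ∈ Icc (0 : ℝ) 1) (n : ℕ) (s : ℂ)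
    (hs : s ∈ oddHurwitzRegion) :
    ‖oddHurwitzTerm a n s‖ ≤ 12 * ((n + 1 : ℕ) : ℝ) ^ (-(3 / 2) : ℝ) :=
  norm_oddHurwitzTerm_le ha n hs.1 (by simpa using hs.2)

lemma hasSum_oddHurwitzTerm_of_one_lt_re {a : ℝ} (ha : a ∈ Icc (0 : ℝ) 1) {s : ℂ}
    (hs : 1 < s.re) :
    HasSum (fun n ↦ oddHurwitzTerm a n s)
      (2 * hurwitzZetaOdd a s - ((a : ℂ) ^ (-s) - ((1 - a : ℝ) : ℂ) ^ (-s)) - (1 - 2 * a)) := by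
  have h1 := (hasSum_nat_add_iff' 1).2 ((hasSum_nat_hurwitzZetaOdd_of_mem_Icc ha hs).mul_left 2)
  have h2 : HasSum (fun n : ℕ ↦ ((n : ℂ) + 1) ^ (-s)) (∑' n : ℕ, ((n : ℂ) + 1) ^ (-s)) := by
    have := (summable_nat_add_iff 1).2 (Complex.summable_one_div_nat_cpow.2 hs)
    simpa [Complex.cpow_neg] using this.hasSum
  have h3 := (hasSum_nat_add_iff' 1).2 h2
  have h4 := h1.sub ((h2.sub h3).mul_left (1 - 2 * a : ℂ))
  convert! h4 using 1
  · funext n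
    simp only [oddHurwitzTerm, Complex.cpow_neg]
    push_cast
    ring
  · simp [Complex.cpow_neg]
    ring

lemma two_mul_hurwitzZetaOdd_eq_tsum {a : ℝ} (ha : a ∈ Ioo (0 : ℝ) 1) {s : ℂ}
    (hs : s ∈ oddHurwitzRegion) :
    2 * hurwitzZetaOdd a s = (a : ℂ) ^ (-s) - ((1 - a : ℝ) : ℂ) ^ (-s) + (1 - 2 * a)
      + ∑' n, oddHurwitzTerm a n s := by
  have ha' := Ioo_subset_Icc_self ha
  have hd : DifferentiableOn ℂ (fun s ↦ (a : ℂ) ^ (-s) - ((1 - a : ℝ) : ℂ) ^ (-s) + (1 - 2 * a)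
      + ∑' n, oddHurwitzTerm a n s) oddHurwitzRegion := by
    refine DifferentiableOn.add (fun z _ ↦ ?_) ?_
    · exact (((hasDerivAt_ofReal_cpow_neg ha.1 z).sub (hasDerivAt_ofReal_cpow_neg
        (sub_pos.2 ha.2) z)).add_const _).differentiableAt.differentiableWithinAt
    · exact Complex.differentiableOn_tsum_of_summable_norm summable_oddHurwitzBound
        (fun n z _ ↦ (hasDerivAt_oddHurwitzTerm ha' n z).differentiableAt.differentiableWithinAt)
        isOpen_oddHurwitzRegion (norm_oddHurwitzTerm_le_of_mem ha')
  have hmem : (3 / 2 : ℂ) ∈ oddHurwitzRegion := by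
    constructor
    · norm_num
    · norm_num
  refine AnalyticOnNhd.eqOn_of_preconnected_of_eventuallyEq
    (((differentiable_hurwitzZetaOdd a).const_mul 2).differentiableOn.analyticOnNhd
      isOpen_oddHurwitzRegion) (hd.analyticOnNhd isOpen_oddHurwitzRegion)
    isPreconnected_oddHurwitzRegion hmem ?_ hs
  have hev : ∀ᶠ z : ℂ in 𝓝 (3 / 2), 1 < z.re :=
    (isOpen_lt continuous_const Complex.continuous_re).mem_nhds (by norm_num)
  filter_upwards [hev] with z hz
  rw [(hasSum_oddHurwitzTerm_of_one_lt_re ha' hz).tsum_eq]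
  ring

lemma zero_mem_oddHurwitzRegion : (0 : ℂ) ∈ oddHurwitzRegion := by
  constructor <;> norm_num

lemma hurwitzZetaOdd_zero {a : ℝ} (ha : a ∈ Ioo (0 : ℝ) 1) :
    hurwitzZetaOdd a 0 = (1 - 2 * a) / 2 := by
  have := two_mul_hurwitzZetaOdd_eq_tsum ha zero_mem_oddHurwitzRegion
  simp only [oddHurwitzTerm, neg_zero, Complex.cpow_zero, sub_self, mul_zero, tsum_zero, zero_add,
    add_zero] at this
  rw [← this]; ring

lemma hasDerivAt_hurwitzZetaOdd_zero {a : ℝ} (ha : a ∈ Ioo (0 : ℝ) 1) :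
    HasDerivAt (hurwitzZetaOdd a)
      (((Real.log (Real.Gamma a) - Real.log (Real.Gamma (1 - a))) / 2 : ℝ) : ℂ) 0 := by
  have ha' := Ioo_subset_Icc_self ha
  have hdiff : ∀ n, DifferentiableOn ℂ (oddHurwitzTerm a n) oddHurwitzRegion := fun n z _ ↦
    (hasDerivAt_oddHurwitzTerm ha' n z).differentiableAt.differentiableWithinAt
  have hsum := Complex.hasSum_deriv_of_summable_norm summable_oddHurwitzBound hdiff
    isOpen_oddHurwitzRegion (norm_oddHurwitzTerm_le_of_mem ha') zero_mem_oddHurwitzRegion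
  have hts := ((Complex.differentiableOn_tsum_of_summable_norm summable_oddHurwitzBound hdiff
    isOpen_oddHurwitzRegion (norm_oddHurwitzTerm_le_of_mem ha')).differentiableAt
    (isOpen_oddHurwitzRegion.mem_nhds zero_mem_oddHurwitzRegion)).hasDerivAt
  have hpartial : ∀ N : ℕ, ∑ n ∈ Finset.range N, deriv (oddHurwitzTerm a n) 0
      = ((Real.BohrMollerup.logGammaSeq a N - Real.BohrMollerup.logGammaSeq (1 - a) N
        + Real.log a - Real.log (1 - a)
        - (1 - 2 * a) * (Real.log (N + 1) - Real.log N) : ℝ) : ℂ) := by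
    intro N
    have hterm : ∀ n : ℕ, deriv (oddHurwitzTerm a n) 0
        = ((-Real.log (n + 1 + a) + Real.log (n + 1 + 1 - a)
          + (1 - 2 * a) * (Real.log (n + 1) - Real.log (n + 1 + 1)) : ℝ) : ℂ) := fun n ↦ by
      rw [(hasDerivAt_oddHurwitzTerm ha' n 0).deriv]
      simp only [neg_zero, Complex.cpow_zero]
      push_cast
      ring
    simp_rw [hterm]
    rw [← Complex.ofReal_sum]
    congr 1
    simp only [Real.BohrMollerup.logGammaSeq]
    rw [Finset.sum_range_succ', Finset.sum_range_succ']
    rw [Finset.sum_add_distrib, Finset.sum_add_distrib, ← Finset.mul_sum]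
    have htel : ∑ n ∈ Finset.range N, (Real.log ((n : ℝ) + 1) - Real.log (n + 1 + 1))
        = -Real.log (N + 1) := by
      have := Finset.sum_range_sub' (fun n : ℕ ↦ Real.log ((n : ℝ) + 1)) N
      simpa using this
    rw [htel, Finset.sum_neg_distrib]
    have e1 : ∀ n : ℕ, a + ((n + 1 : ℕ) : ℝ) = n + 1 + a := fun n ↦ by push_cast; ring
    have e2 : ∀ n : ℕ, 1 - a + ((n + 1 : ℕ) : ℝ) = n + 1 + 1 - a := fun n ↦ by push_cast; ring
    simp only [e1, e2, Nat.cast_zero, add_zero]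
    ring
  have hlim : Tendsto (fun N : ℕ ↦ ∑ n ∈ Finset.range N, deriv (oddHurwitzTerm a n) 0) atTop
      (𝓝 ((Real.log (Real.Gamma a) - Real.log (Real.Gamma (1 - a))
        + Real.log a - Real.log (1 - a) : ℝ) : ℂ)) := by
    simp_rw [hpartial]
    refine (Complex.continuous_ofReal.tendsto _).comp ?_
    have := (((((Real.BohrMollerup.tendsto_log_gamma ha.1).sub
      (Real.BohrMollerup.tendsto_log_gamma (sub_pos.2 ha.2))).add_const (Real.log a)).sub_const
      (Real.log (1 - a))).sub (Real.tendsto_log_nat_add_one_sub_log.const_mul (1 - 2 * a)))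
    simpa using this
  have hval := tendsto_nhds_unique hsum.tendsto_sum_nat hlim
  rw [hval] at hts
  have hfull := ((((hasDerivAt_ofReal_cpow_neg ha.1 0).sub (hasDerivAt_ofReal_cpow_neg
    (sub_pos.2 ha.2) 0)).add_const (1 - 2 * a : ℂ)).add hts).const_mul (1 / 2 : ℂ)
  have heq : hurwitzZetaOdd a =ᶠ[𝓝 0] fun s ↦ (1 / 2 : ℂ) * ((a : ℂ) ^ (-s)
      - ((1 - a : ℝ) : ℂ) ^ (-s) + (1 - 2 * a) + ∑' n, oddHurwitzTerm a n s) := by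
    filter_upwards [isOpen_oddHurwitzRegion.mem_nhds zero_mem_oddHurwitzRegion] with s hs
    rw [← two_mul_hurwitzZetaOdd_eq_tsum ha hs]; ring
  refine (hfull.congr_of_eventuallyEq heq).congr_deriv ?_
  simp only [neg_zero, Complex.cpow_zero]
  push_cast
  ring

/-- The kernel `∑ sin (n θ) exp (-n t)`, in closed form. -/
noncomputable def sinPoissonKernel (θ t : ℝ) : ℝ :=
  Real.sin θ / (Real.exp t + Real.exp (-t) - 2 * Real.cos θ)

lemma two_le_exp_add_exp_neg (t : ℝ) : 2 ≤ Real.exp t + Real.exp (-t) := by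
  have := Real.one_le_cosh t
  rw [Real.cosh_eq] at this
  linarith

lemma hasSum_sinPoissonKernel (θ : ℝ) {t : ℝ} (ht : 0 < t) :
    HasSum (fun n : ℕ ↦ Real.sin (θ * n) * Real.exp (-n * t)) (sinPoissonKernel θ t) := by
  have hnorm : ‖Complex.exp (-t + θ * Complex.I)‖ < 1 := by
    rw [Complex.norm_exp]; simpa using ht
  have h := Complex.hasSum_im (hasSum_geometric_of_norm_lt_one hnorm)
  convert h using 1
  · funext n
    rw [← Complex.exp_nat_mul, Complex.exp_im]
    simp
    ring_nf
  · rw [Complex.inv_im, Complex.normSq_apply]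
    simp only [Complex.sub_im, Complex.one_im, Complex.sub_re, Complex.one_re, Complex.exp_im,
      Complex.exp_re]
    simp only [Complex.add_re, Complex.neg_re, Complex.ofReal_re, Complex.mul_re, Complex.I_re,
      mul_zero, Complex.ofReal_im, Complex.I_im, sub_self, add_zero, Complex.add_im,
      Complex.neg_im, neg_zero, Complex.mul_im, mul_one, zero_add, zero_sub, neg_neg]
    have hden : (1 - Real.exp (-t) * Real.cos θ) * (1 - Real.exp (-t) * Real.cos θ)
        + -(Real.exp (-t) * Real.sin θ) * -(Real.exp (-t) * Real.sin θ)
        = Real.exp (-t) * (Real.exp t + Real.exp (-t) - 2 * Real.cos θ) := by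
      have h1 : Real.exp (-t) * Real.exp t = 1 := by rw [← Real.exp_add]; simp
      linear_combination (Real.exp (-t)) ^ 2 * Real.sin_sq_add_cos_sq θ - h1
    rw [hden, mul_div_mul_left _ _ (Real.exp_pos _).ne', sinPoissonKernel]

lemma mellin_sinPoissonKernel_of_one_lt_re (x : ℝ) {s : ℂ} (hs : 1 < s.re) :
    mellin (fun t ↦ (sinPoissonKernel (2 * π * x) t : ℂ)) s
      = Complex.Gamma s * sinZeta x s := by
  refine (hasSum_mellin (a := fun n : ℕ ↦ (Real.sin (2 * π * x * n) : ℂ)) (p := fun n ↦ n)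
    ?_ (by linarith) ?_ ?_).unique ?_
  · intro n
    rcases Nat.eq_zero_or_pos n with rfl | hn
    · simp
    · exact Or.inr (by exact_mod_cast hn)
  · intro t ht
    exact_mod_cast hasSum_sinPoissonKernel (2 * π * x) ht
  · refine Summable.of_nonneg_of_le (fun n ↦ by positivity) (fun n ↦ ?_)
      (Real.summable_one_div_nat_rpow.2 hs)
    rw [Complex.norm_real]
    gcongr
    exact Real.abs_sin_le_one _
  · simpa only [mul_div_assoc, Complex.ofReal_natCast] using! (hasSum_nat_sinZeta x hs).mul_left (Complex.Gamma s)

section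

variable {θ : ℝ}

lemma sinPoissonKernel_denom_pos (hθ : Real.cos θ < 1) (t : ℝ) :
    0 < Real.exp t + Real.exp (-t) - 2 * Real.cos θ := by
  linarith [two_le_exp_add_exp_neg t]

lemma continuous_sinPoissonKernel (hθ : Real.cos θ < 1) : Continuous (sinPoissonKernel θ) :=
  Continuous.div (by fun_prop) (by fun_prop) fun t ↦ (sinPoissonKernel_denom_pos hθ t).ne'

lemma abs_sinPoissonKernel_le (hθ : Real.cos θ < 1) (t : ℝ) :
    |sinPoissonKernel θ t| ≤ 2 / (1 - Real.cos θ) * Real.exp (-t) := by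
  have hc : 0 < 1 - Real.cos θ := by linarith
  have hden : (1 - Real.cos θ) / 2 * Real.exp t
      ≤ Real.exp t + Real.exp (-t) - 2 * Real.cos θ := by
    nlinarith [two_le_exp_add_exp_neg t, Real.neg_one_le_cos θ, Real.exp_pos (-t)]
  rw [sinPoissonKernel, abs_div, abs_of_pos (sinPoissonKernel_denom_pos hθ t)]
  calc _ ≤ 1 / ((1 - Real.cos θ) / 2 * Real.exp t) := by
        gcongr
        exact Real.abs_sin_le_one _
    _ = _ := by rw [Real.exp_neg]; field_simp

lemma hasDerivAt_mellin_sinPoissonKernel (hθ : Real.cos θ < 1) {s : ℂ} (hs : 0 < s.re) :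
    HasDerivAt (mellin fun t ↦ (sinPoissonKernel θ t : ℂ))
      (mellin (fun t ↦ Real.log t • (sinPoissonKernel θ t : ℂ)) s) s := by
  have htop : (fun t ↦ (sinPoissonKernel θ t : ℂ)) =O[atTop] fun t ↦ Real.exp (-1 * t) := by
    refine IsBigO.of_bound (2 / (1 - Real.cos θ)) (Eventually.of_forall fun t ↦ ?_)
    simpa using abs_sinPoissonKernel_le hθ t
  have hcont : Continuous fun t ↦ (sinPoissonKernel θ t : ℂ) :=
    Complex.continuous_ofReal.comp (continuous_sinPoissonKernel hθ)
  refine (mellin_hasDerivAt_of_isBigO_rpow (a := s.re + 1) (b := 0)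
    (hcont.locallyIntegrable.locallyIntegrableOn _)
    (htop.trans (isLittleO_exp_neg_mul_rpow_atTop one_pos _).isBigO) (by linarith) ?_ hs).2
  simpa using (hcont.tendsto 0).isBigO_one ℝ |>.mono nhdsWithin_le_nhds

end

lemma mellin_sinPoissonKernel {x : ℝ} (hx : Real.cos (2 * π * x) < 1) {s : ℂ} (hs : 0 < s.re) :
    mellin (fun t ↦ (sinPoissonKernel (2 * π * x) t : ℂ)) s
      = Complex.Gamma s * sinZeta x s := by
  have hopen : IsOpen {z : ℂ | 0 < z.re} := isOpen_lt continuous_const Complex.continuous_re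
  have hΓ : DifferentiableOn ℂ (fun z ↦ Complex.Gamma z * sinZeta x z) {z : ℂ | 0 < z.re} := by
    refine DifferentiableOn.mul (fun z hz ↦ ?_) (differentiableAt_sinZeta x).differentiableOn
    refine (Complex.differentiableAt_Gamma z fun m hm ↦ ?_).differentiableWithinAt
    have : z.re ≤ 0 := by simp [hm]
    exact absurd hz (not_lt.2 this)
  refine AnalyticOnNhd.eqOn_of_preconnected_of_eventuallyEq (z₀ := 2)
    (DifferentiableOn.analyticOnNhd (fun z hz ↦ (hasDerivAt_mellin_sinPoissonKernel hx
      hz).differentiableAt.differentiableWithinAt) hopen) (hΓ.analyticOnNhd hopen)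
    (convex_halfSpace_re_gt 0).isPreconnected (show (0 : ℝ) < (2 : ℂ).re by simp) ?_ hs
  have hev : ∀ᶠ z : ℂ in 𝓝 2, 1 < z.re :=
    (isOpen_lt continuous_const Complex.continuous_re).mem_nhds (by norm_num)
  filter_upwards [hev] with z hz using mellin_sinPoissonKernel_of_one_lt_re x hz

lemma cos_two_pi_mul_lt_one {x : ℝ} (hx : x ∈ Ioo (0 : ℝ) 1) : Real.cos (2 * π * x) < 1 := by
  refine lt_of_le_of_ne (Real.cos_le_one _) fun h ↦ ?_
  have h0 : 0 < 2 * π * x := by have := hx.1; positivity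
  have h1 : 2 * π * x < 2 * π := by nlinarith [Real.pi_pos, hx.2]
  exact h0.ne' ((Real.cos_eq_one_iff_of_lt_of_lt (by linarith [Real.pi_pos]) h1).1 h)

/-- Malmsten's integral with a parameter, in exponential coordinates. -/
lemma integral_log_mul_sinPoissonKernel {x : ℝ} (hx : x ∈ Ioo (0 : ℝ) 1) :
    ∫ t in Ioi (0 : ℝ), Real.log t * sinPoissonKernel (2 * π * x) t
      = π / 2 * ((1 - 2 * x) * Real.log (2 * π)
        + Real.log (Real.Gamma (1 - x)) - Real.log (Real.Gamma x)) := by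
  have hc := cos_two_pi_mul_lt_one hx
  set F : ℂ → ℂ := mellin fun t ↦ (sinPoissonKernel (2 * π * x) t : ℂ) with hF
  have hpi : (2 * π : ℂ) ≠ 0 := by exact_mod_cast Real.two_pi_pos.ne'
  have hfun : (fun s ↦ F s * Complex.sin (π * s / 2))
      =ᶠ[𝓝 1] fun s ↦ 1 / 2 * ((2 * π : ℂ) ^ s * hurwitzZetaOdd x (1 - s)) := by
    have hev : ∀ᶠ z : ℂ in 𝓝 1, 0 < z.re :=
      (isOpen_lt continuous_const Complex.continuous_re).mem_nhds (by norm_num)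
    filter_upwards [hev] with s hs
    have hne : ∀ n : ℕ, s ≠ -n := fun n hn ↦ by
      have : s.re ≤ 0 := by simp [hn]
      linarith
    rw [hF, mellin_sinPoissonKernel hc hs, hurwitzZetaOdd_one_sub _ hne, Complex.cpow_neg]
    have : (2 * π : ℂ) ^ s ≠ 0 := by simp [Complex.cpow_eq_zero_iff, hpi]
    field_simp
  have hsin : HasDerivAt (fun s : ℂ ↦ Complex.sin (π * s / 2)) 0 1 := by
    have h := (((hasDerivAt_id (1 : ℂ)).const_mul (π : ℂ)).div_const 2).csin
    simpa using h
  have hF' := hasDerivAt_mellin_sinPoissonKernel hc (s := 1) (by simp)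
  have hL := hF'.mul hsin
  have hH : HasDerivAt (fun s : ℂ ↦ hurwitzZetaOdd x (1 - s)) _ 1 :=
    HasDerivAt.comp_const_sub 1 1 (by simpa using hasDerivAt_hurwitzZetaOdd_zero hx)
  have hP : HasDerivAt (fun s : ℂ ↦ (2 * π : ℂ) ^ s) _ 1 :=
    (hasDerivAt_id (1 : ℂ)).const_cpow (Or.inl hpi)
  have hR := (hP.mul hH).const_mul (1 / 2 : ℂ)
  have hkey := hL.unique (hR.congr_of_eventuallyEq hfun)
  have hlog : Complex.log (2 * π) = (Real.log (2 * π) : ℂ) := by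
    rw [Complex.ofReal_log Real.two_pi_pos.le]; push_cast; rfl
  have hone : mellin (fun t ↦ Real.log t • (sinPoissonKernel (2 * π * x) t : ℂ)) 1
      = ((∫ t in Ioi (0 : ℝ), Real.log t * sinPoissonKernel (2 * π * x) t : ℝ) : ℂ) := by
    simp only [mellin, sub_self, Complex.cpow_zero, one_smul]
    rw [← integral_complex_ofReal]
    simp
  rw [hone] at hkey
  simp only [id, mul_one, mul_zero, add_zero, Complex.cpow_one, sub_self, hurwitzZetaOdd_zero hx,
    hlog, Complex.sin_pi_div_two] at hkey
  apply Complex.ofReal_injective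
  rw [hkey]
  push_cast
  ring

/-- Malmsten's integral with a parameter. -/
theorem integral_log_log_inv_div {x : ℝ} (hx : x ∈ Ioo (0 : ℝ) 1) :
    ∫ y in Ioo (0 : ℝ) 1,
        Real.log (Real.log (1 / y)) * (Real.sin (2 * π * x)
          / (1 - 2 * y * Real.cos (2 * π * x) + y ^ 2))
      = π / 2 * ((1 - 2 * x) * Real.log (2 * π)
        + Real.log (Real.Gamma (1 - x)) - Real.log (Real.Gamma x)) := by
  rw [← integral_log_mul_sinPoissonKernel hx]
  have himage : (fun t ↦ Real.exp (-t)) '' Ioi 0 = Ioo 0 1 := by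
    ext y
    constructor
    · rintro ⟨t, ht, rfl⟩
      exact ⟨Real.exp_pos _, Real.exp_lt_one_iff.2 (neg_lt_zero.2 ht)⟩
    · rintro ⟨h0, h1⟩
      exact ⟨-Real.log y, neg_pos.2 (Real.log_neg h0 h1), by simp [Real.exp_log h0]⟩
  rw [← himage, integral_image_eq_integral_abs_deriv_smul measurableSet_Ioi
    (f' := fun t ↦ -Real.exp (-t))
    (fun t _ ↦ by simpa using (hasDerivAt_neg t).exp.hasDerivWithinAt)
    (fun s _ t _ h ↦ by simpa using h)]
  refine setIntegral_congr_fun measurableSet_Ioi fun t _ ↦ ?_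
  have hden := sinPoissonKernel_denom_pos (cos_two_pi_mul_lt_one hx) t
  have h1 : Real.exp (-t) * Real.exp t = 1 := by rw [← Real.exp_add]; simp
  have hrw : 1 - 2 * Real.exp (-t) * Real.cos (2 * π * x) + Real.exp (-t) ^ 2
      = Real.exp (-t) * (Real.exp t + Real.exp (-t) - 2 * Real.cos (2 * π * x)) := by
    linear_combination -h1
  simp only [abs_neg, abs_of_pos (Real.exp_pos _), smul_eq_mul, one_div, Real.log_inv,
    Real.log_exp, neg_neg, sinPoissonKernel]
  rw [hrw]
  have := (Real.exp_pos (-t)).ne'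
  field_simp

theorem malmsten_integral_one :
    ∫ x in Set.Ioo (0 : ℝ) 1, Real.log (Real.log (1 / x)) / (1 + x + x ^ 2)
      = (Real.pi / Real.sqrt 3) *
          Real.log ((2 * Real.pi) ^ ((1 : ℝ) / 3) * Real.Gamma (2 / 3) /
            Real.Gamma (1 / 3)) := by
  have hangle : 2 * π * (1 / 3) = π - π / 3 := by ring
  have hmain := integral_log_log_inv_div (x := 1 / 3) (by constructor <;> norm_num)
  rw [hangle, Real.sin_pi_sub, Real.cos_pi_sub, Real.sin_pi_div_three, Real.cos_pi_div_three]
    at hmain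
  have hint : ∀ y : ℝ, Real.log (Real.log (1 / y)) * (√3 / 2 / (1 - 2 * y * -(1 / 2) + y ^ 2))
      = √3 / 2 * (Real.log (Real.log (1 / y)) / (1 + y + y ^ 2)) := fun y ↦ by
    rw [show 1 - 2 * y * -(1 / 2) + y ^ 2 = 1 + y + y ^ 2 by ring]; ring
  simp_rw [hint] at hmain
  rw [integral_const_mul] at hmain
  have h1 := (Real.Gamma_pos_of_pos (show (0 : ℝ) < 1 / 3 by norm_num))
  have h2 := (Real.Gamma_pos_of_pos (show (0 : ℝ) < 2 / 3 by norm_num))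
  have h3 := Real.rpow_pos_of_pos Real.two_pi_pos (1 / 3)
  rw [Real.log_div (by positivity) h1.ne', Real.log_mul h3.ne' h2.ne',
    Real.log_rpow Real.two_pi_pos]
  rw [show (1 : ℝ) - 1 / 3 = 2 / 3 by norm_num] at hmain
  have hs : √3 ≠ 0 := by positivity
  field_simp at hmain ⊢
  linear_combination hmain
end
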